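/- For every nonzero integer m, all integers x and y satisfying x³ − 2y³ = m satisfy max{|x|, |y|} ≤ (300000·|m|)^23. -/

import Mathlib

namespace CubicPade

open Finset Nat

/-- Partial fraction expansion of `n! / (x (x + 1) ⋯ (x + n))`. -/
theorem sum_choose_div_add (n : ℕ) : ∀ x : ℝ, (∀ i : ℕ, x + i ≠ 0) →
    ∑ a ∈ range (n + 1), (-1 : ℝ) ^ a * n.choose a / (x + a)
      = n ! / ∏ i ∈ range (n + 1), (x + i) := by
  induction n with
  | zero => intro x hx; simp
  | succ n ih =>
    intro x hx
    have hx' : ∀ i : ℕ, (x + 1) + i ≠ 0 := fun i => by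
      have := hx (i + 1); push_cast at this; rwa [add_right_comm, add_assoc]
    have e : ∑ a ∈ range (n + 1 + 1), (-1 : ℝ) ^ a * (n + 1).choose a / (x + a)
        = ∑ a ∈ range (n + 1), (-1 : ℝ) ^ a * n.choose a / (x + a)
          - ∑ a ∈ range (n + 1), (-1 : ℝ) ^ a * n.choose a / (x + 1 + a) := by
      have h1 : ∑ a ∈ range (n + 1), (-1 : ℝ) ^ a * n.choose a / (x + a) =
          ∑ a ∈ range (n + 1 + 1), (-1 : ℝ) ^ a * n.choose a / (x + a) := by
        rw [sum_range_succ _ (n + 1)]; simp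
      rw [h1, sum_range_succ', sum_range_succ' _ (n + 1), add_sub_right_comm, ← sum_sub_distrib]
      congr 1
      · refine sum_congr rfl fun a _ => ?_
        rw [Nat.choose_succ_succ]
        push_cast
        rw [add_assoc x 1 (a : ℝ), add_comm (1 : ℝ) a]
        ring
      · simp
    rw [e, ih x hx, ih (x + 1) hx']
    have p1 : ∏ i ∈ range (n + 1 + 1), (x + (i : ℝ))
        = (∏ i ∈ range (n + 1), (x + (i : ℝ))) * (x + (n + 1)) := by
      rw [prod_range_succ]; push_cast; rfl
    have p2 : ∏ i ∈ range (n + 1 + 1), (x + (i : ℝ))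
        = (∏ i ∈ range (n + 1), (x + 1 + (i : ℝ))) * x := by
      rw [prod_range_succ']
      push_cast
      rw [add_zero]
      exact congrArg (· * x) (prod_congr rfl fun i _ => by ring)
    have n1 : ∏ i ∈ range (n + 1), (x + (i : ℝ)) ≠ 0 := prod_ne_zero_iff.2 fun i _ => hx i
    have n2 : ∏ i ∈ range (n + 1), (x + 1 + (i : ℝ)) ≠ 0 := prod_ne_zero_iff.2 fun i _ => hx' i
    have n3 : x ≠ 0 := by simpa using hx 0
    have n4 : x + (n + 1) ≠ 0 := by simpa using hx (n + 1)
    have q : ∏ i ∈ range (n + 1), (x + 1 + (i : ℝ))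
      = (∏ i ∈ range (n + 1), (x + (i : ℝ))) * (x + (n + 1)) / x := by
      rw [← p1, p2]; field_simp
    rw [p1, q, Nat.factorial_succ]
    push_cast
    field_simp
    ring

theorem factorial_mul_choose_add (x : ℝ) (k : ℕ) :
    (k ! : ℝ) * Ring.choose (x + k) k = ∏ i ∈ range k, (x + 1 + i) := by
  have h := Ring.factorial_nsmul_multichoose_eq_ascPochhammer (x + 1) k
  have hp : ∀ j : ℕ, (ascPochhammer ℝ j).eval (x + 1) = ∏ i ∈ range j, (x + 1 + i) := fun j => by
    induction j with
    | zero => simp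
    | succ j ih => rw [ascPochhammer_succ_eval, ih, prod_range_succ]
  rw [Ring.multichoose_eq, Polynomial.ascPochhammer_smeval_eq_eval, hp, nsmul_eq_mul] at h
  rw [← h]
  congr 2
  ring

theorem factorial_dvd_three_pow_mul_prod (k : ℕ) (s : ℤ) :
    (k ! : ℤ) ∣ 3 ^ (k / 2) * ∏ i ∈ range k, (3 * (i : ℤ) + s) := by
  obtain ⟨v, m, hm, hk⟩ := Nat.exists_eq_pow_mul_and_not_dvd (factorial_ne_zero k) 3 (by norm_num)
  have hv : v ≤ k / 2 := by
    have : Fact (Nat.Prime 3) := ⟨Nat.prime_three⟩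
    have h := sub_one_mul_padicValNat_factorial (p := 3) k
    have hv : padicValNat 3 k ! = v := by
      have hm0 : m ≠ 0 := by rintro rfl; simp at hm
      rw [hk, padicValNat.mul (by positivity) hm0, padicValNat.prime_pow,
        padicValNat.eq_zero_of_not_dvd hm, add_zero]
    rw [hv] at h
    omega
  have hc : IsCoprime (3 : ℤ) (m : ℤ) := by
    have := (Nat.prime_three.coprime_iff_not_dvd).2 hm
    exact_mod_cast Nat.isCoprime_iff_coprime.2 this
  obtain ⟨u, t, hut⟩ := hc
  have hmod : (u ^ k * ∏ i ∈ range k, (3 * (i : ℤ) + s)) ≡ ∏ i ∈ range k, (u * s + i) [ZMOD m] := by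
    have : u ^ k * ∏ i ∈ range k, (3 * (i : ℤ) + s) = ∏ i ∈ range k, (u * (3 * (i : ℤ) + s)) := by
      rw [prod_mul_distrib]; simp
    rw [this]
    refine Int.ModEq.prod fun i _ => ?_
    refine (Int.modEq_iff_dvd.2 ⟨t * i, ?_⟩)
    linear_combination (-(i : ℤ)) * hut
  have hdvd : (m : ℤ) ∣ ∏ i ∈ range k, (3 * (i : ℤ) + s) := by
    have h1 : (m : ℤ) ∣ ∏ i ∈ range k, (u * s + i) :=
      (Dvd.intro_left ((3 : ℤ) ^ v) (by rw [hk]; push_cast; rfl)).trans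
        (Nat.factorial_coe_dvd_prod k (u * s))
    have h2 := (Int.ModEq.dvd_iff hmod.symm).1 h1
    have hcu : IsCoprime (m : ℤ) (u ^ k) := IsCoprime.pow_right ⟨t, 3, by linarith⟩
    exact hcu.dvd_of_dvd_mul_left h2
  rw [hk]
  push_cast
  exact mul_dvd_mul (pow_dvd_pow 3 hv) hdvd

/-- The quotient of `padePoly ν n` by `padePoly (-ν) n` is the diagonal Padé approximant of order
`n` to `w ^ ν` at `w = 1`. -/
noncomputable def padePoly (ν : ℝ) (n : ℕ) (w : ℝ) : ℝ :=
  ∑ b ∈ range (n + 1), Ring.choose (n + ν) b * Ring.choose (n - ν) (n - b) * w ^ b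

theorem choose_mul_choose_sub (x y : ℝ) (n k : ℕ) (hk : k ≤ n) (hxy : x + y = 2 * n) :
    ∑ b ∈ range (n + 1), (b.choose k : ℝ) * (Ring.choose x b * Ring.choose y (n - b))
      = Ring.choose x k * (2 * n - k).choose n := by
  obtain ⟨c, rfl⟩ := Nat.exists_eq_add_of_le hk
  have h1 : Ring.choose ((x - k) + y) c = ((2 * (k + c) - k).choose (k + c) : ℝ) := by
    have : (x - k) + y = ((2 * (k + c) - k : ℕ) : ℝ) := by
      rw [Nat.cast_sub (by omega)]; push_cast at hxy ⊢; linarith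
    rw [this, Ring.choose_natCast]
    congr 1
    apply Nat.choose_symm_of_eq_add
    omega
  rw [← h1, Ring.add_choose_eq c (Commute.all _ _), Nat.sum_antidiagonal_eq_sum_range_succ
    (fun i j => Ring.choose (x - k) i * Ring.choose y j), mul_sum, add_assoc, sum_range_add,
    sum_eq_zero, zero_add]
  · refine sum_congr rfl fun b _ => ?_
    have h2 := Ring.choose_add_smul_choose (x - k) b k
    rw [nsmul_eq_mul, sub_add_cancel] at h2
    rw [Nat.add_sub_add_left, add_comm k b, ← mul_assoc, h2]
    ring
  · intro b hb
    rw [Nat.choose_eq_zero_of_lt (mem_range.1 hb)]; simp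

theorem padePoly_one_sub (ν : ℝ) (n : ℕ) (z : ℝ) :
    padePoly ν n (1 - z)
      = ∑ k ∈ range (n + 1), (-z) ^ k * (Ring.choose (n + ν) k * (2 * n - k).choose n) := by
  have h : ∀ b ∈ range (n + 1), (1 - z) ^ b = ∑ k ∈ range (n + 1), (-z) ^ k * b.choose k := by
    intro b hb
    have hb' : b + 1 ≤ n + 1 := by have := mem_range.1 hb; omega
    rw [sub_eq_neg_add, add_pow]
    simp only [one_pow, mul_one]
    refine sum_subset (range_subset_range.2 hb') fun k _ hk => ?_
    rw [Nat.choose_eq_zero_of_lt (by simpa using hk)]; simp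
  unfold padePoly
  rw [sum_congr rfl fun b hb => by rw [h b hb, mul_sum], sum_comm]
  refine sum_congr rfl fun k hk => ?_
  rw [← choose_mul_choose_sub (n + ν) (n - ν) n k (by have := mem_range.1 hk; omega) (by ring),
    mul_sum]
  exact sum_congr rfl fun b _ => by ring

theorem exists_int_three_pow_mul_choose (ε : ℤ) (n k : ℕ) (hk : k ≤ n) :
    ∃ N : ℤ, (3 : ℝ) ^ k * 3 ^ (n / 2) * Ring.choose ((n : ℝ) + ε / 3) k = N := by
  obtain ⟨c, rfl⟩ := Nat.exists_eq_add_of_le hk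
  obtain ⟨N, hN⟩ := factorial_dvd_three_pow_mul_prod k (3 * (c + 1) + ε)
  have h := factorial_mul_choose_add ((c : ℝ) + ε / 3) k
  have hf : (k ! : ℝ) ≠ 0 := by positivity
  refine ⟨3 ^ ((k + c) / 2 - k / 2) * N, mul_left_cancel₀ hf ?_⟩
  have hN' : (3 : ℝ) ^ (k / 2) * ∏ i ∈ range k, (3 * (i : ℝ) + (3 * (c + 1) + ε)) = k ! * N := by
    exact_mod_cast hN
  have hp : (3 : ℝ) ^ k * ∏ i ∈ range k, ((c : ℝ) + ε / 3 + 1 + i)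
      = ∏ i ∈ range k, (3 * (i : ℝ) + (3 * (c + 1) + ε)) := by
    rw [← card_range k, ← prod_const, card_range, ← prod_mul_distrib]
    exact prod_congr rfl fun i _ => by ring
  have h3 : (3 : ℝ) ^ ((k + c) / 2) = 3 ^ ((k + c) / 2 - k / 2) * 3 ^ (k / 2) := by
    rw [← pow_add]; congr 1; omega
  have e : ((k + c : ℕ) : ℝ) + ε / 3 = (c : ℝ) + ε / 3 + k := by push_cast; ring
  rw [e]
  push_cast
  calc _ = 3 ^ ((k + c) / 2) * (3 ^ k * (k ! * Ring.choose ((c : ℝ) + ε / 3 + k) k)) := by ring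
    _ = _ := by rw [h, hp, h3, mul_assoc, hN']; ring

theorem exists_int_mul_padePoly (ε : ℤ) (n : ℕ) :
    ∃ N : ℤ, (128 : ℝ) ^ n * 3 ^ (n / 2) * padePoly (ε / 3) n (125 / 128) = N := by
  choose! f hf using fun k (hk : k ≤ n) => exists_int_three_pow_mul_choose ε n k hk
  refine ⟨∑ k ∈ range (n + 1), (-1) ^ k * 128 ^ (n - k) * f k * (2 * n - k).choose n, ?_⟩
  rw [show (125 / 128 : ℝ) = 1 - 3 / 128 by norm_num, padePoly_one_sub, mul_sum]
  push_cast
  refine sum_congr rfl fun k hk => ?_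
  have hk' : k ≤ n := by have := mem_range.1 hk; omega
  rw [← hf k hk', neg_pow, div_pow]
  have : (128 : ℝ) ^ n = 128 ^ (n - k) * 128 ^ k := by rw [← pow_add]; congr 1; omega
  rw [this]
  field_simp

theorem choose_add_nonneg {x : ℝ} (hx : -1 ≤ x) (k : ℕ) : 0 ≤ Ring.choose (x + k) k := by
  have h := factorial_mul_choose_add x k
  have : 0 ≤ ∏ i ∈ range k, (x + 1 + i) := prod_nonneg fun i _ => by
    have : (0 : ℝ) ≤ i := by positivity
    linarith
  rw [← h] at this
  exact nonneg_of_mul_nonneg_right this (by positivity)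

theorem choose_add_le_choose_add {x y : ℝ} (hx : -1 ≤ x) (hxy : x ≤ y) (k : ℕ) :
    Ring.choose (x + k) k ≤ Ring.choose (y + k) k := by
  have : ∏ i ∈ range k, (x + 1 + i) ≤ ∏ i ∈ range k, (y + 1 + i) :=
    prod_le_prod (fun i _ => by
      have : (0 : ℝ) ≤ i := by positivity
      linarith) fun i _ => by linarith
  rw [← factorial_mul_choose_add x k, ← factorial_mul_choose_add y k] at this
  exact le_of_mul_le_mul_left this (by positivity)

theorem padePoly_le {ν w : ℝ} (h0 : 0 ≤ ν) (h1 : ν ≤ 1) (hw : 0 ≤ w) (n : ℕ) :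
    padePoly ν n w ≤ 2 * (2 * (1 + w)) ^ n := by
  have hb : ∀ b ∈ range (n + 1), Ring.choose (n + ν) b * Ring.choose (n - ν) (n - b) * w ^ b
      ≤ 2 ^ (n + 1) * (w ^ b * 1 ^ (n - b) * n.choose b) := by
    intro b hb
    obtain ⟨c, rfl⟩ := Nat.exists_eq_add_of_le (Nat.lt_succ_iff.1 (mem_range.1 hb))
    rw [Nat.add_sub_cancel_left]
    have c0 : (0 : ℝ) ≤ c := by positivity
    have b0 : (0 : ℝ) ≤ b := by positivity
    have e1 := choose_add_le_choose_add (x := c + ν) (y := c + 1) (by linarith) (by linarith) b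
    have e2 := choose_add_le_choose_add (x := b - ν) (y := b) (by linarith) (by linarith) c
    have e3 := choose_add_nonneg (x := b - ν) (by linarith) c
    have e4 : Ring.choose ((c : ℝ) + 1 + b) b ≤ 2 ^ (b + c + 1) := by
      rw [show (c : ℝ) + 1 + b = ((b + c + 1 : ℕ) : ℝ) by push_cast; ring, Ring.choose_natCast]
      exact_mod_cast Nat.choose_le_two_pow _ _
    have e5 : Ring.choose ((b : ℝ) + c) c = ((b + c).choose b : ℝ) := by
      rw [← Nat.cast_add, Ring.choose_natCast, Nat.choose_symm_add]
    rw [e5] at e2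
    rw [show ((b + c : ℕ) : ℝ) + ν = c + ν + b by push_cast; ring,
      show ((b + c : ℕ) : ℝ) - ν = b - ν + c by push_cast; ring]
    calc _ ≤ 2 ^ (b + c + 1) * ((b + c).choose b : ℝ) * w ^ b := by
          have := e1.trans e4
          gcongr
      _ = _ := by ring
  calc padePoly ν n w ≤ _ := sum_le_sum hb
    _ = 2 * (2 * (1 + w)) ^ n := by
      rw [← mul_sum, ← add_pow, mul_pow 2 (1 + w), add_comm w 1]; ring

theorem padePoly_le_succ {ν w : ℝ} (h0 : ν ≤ 0) (h1 : -1 ≤ ν) (hw : 0 ≤ w) (n : ℕ) :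
    padePoly ν n w ≤ padePoly ν (n + 1) w := by
  unfold padePoly
  rw [sum_range_succ _ (n + 1)]
  refine le_add_of_le_of_nonneg (sum_le_sum fun b hb => ?_) ?_
  · obtain ⟨c, rfl⟩ := Nat.exists_eq_add_of_le (Nat.lt_succ_iff.1 (mem_range.1 hb))
    rw [Nat.add_sub_cancel_left, show b + c + 1 - b = c + 1 by omega]
    have c0 : (0 : ℝ) ≤ c := by positivity
    have b0 : (0 : ℝ) ≤ b := by positivity
    have e1 := choose_add_le_choose_add (x := c + ν) (y := c + 1 + ν) (by linarith) (by linarith) b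
    have e2 := choose_add_nonneg (x := c + ν) (by linarith) b
    have e3 := choose_add_nonneg (x := b - ν) (by linarith) c
    have e4 := choose_add_nonneg (x := b - ν - 1) (by linarith) (c + 1)
    have e5 := Ring.choose_succ_succ ((b : ℝ) - ν + c) c
    rw [show (b : ℝ) - ν - 1 + (c + 1 : ℕ) = b - ν + c by push_cast; ring] at e4
    rw [show ((b + c : ℕ) : ℝ) + ν = c + ν + b by push_cast; ring,
      show ((b + c : ℕ) : ℝ) - ν = b - ν + c by push_cast; ring,
      show ((b + c + 1 : ℕ) : ℝ) + ν = c + 1 + ν + b by push_cast; ring,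
      show ((b + c + 1 : ℕ) : ℝ) - ν = b - ν + c + 1 by push_cast; ring, e5]
    have e6 : Ring.choose ((b : ℝ) - ν + c) c
      ≤ Ring.choose ((b : ℝ) - ν + c) c + Ring.choose ((b : ℝ) - ν + c) (c + 1) := by linarith
    exact mul_le_mul_of_nonneg_right (mul_le_mul e1 e6 e3 (e2.trans e1)) (by positivity)
  · have e := choose_add_nonneg h1 (n + 1)
    rw [add_comm ν] at e
    rw [Nat.sub_self, Ring.choose_zero_right, mul_one]
    positivity

theorem one_le_padePoly {ν w : ℝ} (h0 : ν ≤ 0) (h1 : -1 ≤ ν) (hw : 0 ≤ w) (n : ℕ) :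
    1 ≤ padePoly ν n w := by
  induction n with
  | zero => simp [padePoly]
  | succ n ih => exact ih.trans (padePoly_le_succ h0 h1 hw n)

/-- The normalising factor `∏ (1 - ν² / i²)`, `1 ≤ i ≤ n`, between the integral remainder and the
Padé approximants. -/
noncomputable def padeScale (ν : ℝ) (n : ℕ) : ℝ :=
  (∏ i ∈ range n, ((i : ℝ) + 1 + ν)) * (∏ i ∈ range n, ((i : ℝ) + 1 - ν)) / (n ! : ℝ) ^ 2

theorem padeScale_succ (ν : ℝ) (n : ℕ) :
    padeScale ν (n + 1) = padeScale ν n * (1 - ν ^ 2 / ((n : ℝ) + 1) ^ 2) := by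
  have : (n : ℝ) + 1 ≠ 0 := by positivity
  simp only [padeScale, prod_range_succ, Nat.factorial_succ]
  push_cast
  field_simp
  ring

theorem padeScale_neg (ν : ℝ) (n : ℕ) : padeScale (-ν) n = padeScale ν n := by
  simp only [padeScale, sub_neg_eq_add, ← sub_eq_add_neg]
  rw [mul_comm (∏ i ∈ range n, ((i : ℝ) + 1 - ν))]

theorem padeScale_mul_sum (ν : ℝ) (hν : ∀ i : ℤ, ν + i ≠ 0) (n b : ℕ) (hb : b ≤ n) :
    ν * padeScale ν n * ((-1) ^ b * n.choose b *
        ∑ a ∈ range (n + 1), (-1 : ℝ) ^ a * n.choose a / (ν - b + a))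
      = Ring.choose (n + ν) b * Ring.choose (n - ν) (n - b) := by
  obtain ⟨c, rfl⟩ := Nat.exists_eq_add_of_le hb
  rw [sum_choose_div_add _ _ fun i => by
      have := hν (i - b); push_cast at this; convert this using 1; ring,
    Nat.add_sub_cancel_left, padeScale]
  have f1 := factorial_mul_choose_add (c + ν) b
  have f2 := factorial_mul_choose_add (b - ν) c
  have hneg : ∏ i ∈ range b, (ν - b + (i : ℝ)) = (-1) ^ b * ∏ i ∈ range b, ((i : ℝ) + 1 - ν) := by
    rw [← prod_range_reflect, ← card_range b, ← prod_const, card_range, ← prod_mul_distrib]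
    refine prod_congr rfl fun i hi => ?_
    have := mem_range.1 hi
    rw [Nat.sub_sub, Nat.cast_sub (by omega)]
    push_cast
    ring
  have hpos : ∏ i ∈ range (c + 1), (ν - b + ((b + i : ℕ) : ℝ))
      = (∏ i ∈ range c, ((i : ℝ) + 1 + ν)) * ν := by
    rw [prod_range_succ']
    congr 1
    · exact prod_congr rfl fun i _ => by push_cast; ring
    · simp
  have g1 : ∏ i ∈ range (b + c), ((i : ℝ) + 1 + ν)
      = (∏ i ∈ range c, ((i : ℝ) + 1 + ν)) * ∏ i ∈ range b, (c + ν + 1 + (i : ℝ)) := by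
    rw [add_comm, prod_range_add]
    congr 1
    exact prod_congr rfl fun i _ => by push_cast; ring
  have g2 : ∏ i ∈ range (b + c), ((i : ℝ) + 1 - ν)
      = (∏ i ∈ range b, ((i : ℝ) + 1 - ν)) * ∏ i ∈ range c, (b - ν + 1 + (i : ℝ)) := by
    rw [prod_range_add]
    congr 1
    exact prod_congr rfl fun i _ => by push_cast; ring
  have n0 : ν ≠ 0 := by simpa using hν 0
  have n1 : ∏ i ∈ range c, ((i : ℝ) + 1 + ν) ≠ 0 := prod_ne_zero_iff.2 fun i _ => by
    have := hν (i + 1); push_cast at this; rwa [add_comm] at this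
  have n2 : ∏ i ∈ range b, ((i : ℝ) + 1 - ν) ≠ 0 := prod_ne_zero_iff.2 fun i _ => by
    have := hν (-(i + 1)); push_cast at this
    intro h0
    exact this (by linarith)
  have hc : ((b + c).choose b : ℝ) * b ! * c ! = (b + c)! := by
    rw [Nat.choose_symm_add]
    exact_mod_cast Nat.add_choose_mul_factorial_mul_factorial b c
  have hc' : ((b + c).choose b : ℝ) = (b + c)! / (b ! * c !) := by
    rw [← hc]; field_simp
  rw [g1, g2, add_assoc b c 1, prod_range_add (fun i => ν - b + (i : ℝ)), hneg, hpos, ← f1, ← f2, hc',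
    show ((b + c : ℕ) : ℝ) + ν = c + ν + b by push_cast; ring,
    show ((b + c : ℕ) : ℝ) - ν = b - ν + c by push_cast; ring]
  have hs : ((-1 : ℝ) ^ b) ≠ 0 := by positivity
  field_simp

theorem integral_padeKernel {u : ℝ} (hu : 0 < u) (n : ℕ) :
    ∫ t in u..1, ((1 - t ^ 3) * (1 - u ^ 3 / t ^ 3)) ^ n
      = ∑ a ∈ range (n + 1), ∑ b ∈ range (n + 1), (-1 : ℝ) ^ a * n.choose a *
          ((-1) ^ b * n.choose b) * (((u ^ 3) ^ b - u * (u ^ 3) ^ a) / (3 * (a - b) + 1)) := by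
  have z3 : ∀ x : ℝ, x ^ (3 : ℤ) = x ^ 3 := fun x => zpow_natCast x 3
  have hpos : ∀ t ∈ Set.uIcc u 1, t ≠ 0 := fun t ht =>
    ((lt_min hu one_pos).trans_le ht.1).ne'
  have h0 : (0 : ℝ) ∉ Set.uIcc u 1 := fun h => hpos 0 h rfl
  have hexp : ∀ t ∈ Set.uIcc u 1, ((1 - t ^ 3) * (1 - u ^ 3 / t ^ 3)) ^ n
      = ∑ a ∈ range (n + 1), ∑ b ∈ range (n + 1), (-1 : ℝ) ^ a * n.choose a *
          ((-1) ^ b * n.choose b) * (u ^ 3) ^ b * t ^ (3 * ((a : ℤ) - b)) := by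
    intro t ht
    have ht0 := hpos t ht
    rw [mul_pow, sub_eq_neg_add, add_pow, sub_eq_neg_add, add_pow, sum_mul_sum]
    refine sum_congr rfl fun a _ => sum_congr rfl fun b _ => ?_
    rw [mul_sub, zpow_sub₀ ht0, zpow_mul, zpow_mul, zpow_natCast, zpow_natCast, neg_pow,
      neg_pow (u ^ 3 / t ^ 3), div_pow]
    simp only [z3, one_pow, mul_one]
    field_simp
  have hint : ∀ k : ℤ, IntervalIntegrable (fun t : ℝ => t ^ k) MeasureTheory.volume u 1 :=
    fun k => intervalIntegral.intervalIntegrable_zpow (Or.inr h0)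
  rw [intervalIntegral.integral_congr hexp, intervalIntegral.integral_finsetSum]
  · refine sum_congr rfl fun a _ => ?_
    rw [intervalIntegral.integral_finsetSum fun b _ => (hint _).const_mul _]
    refine sum_congr rfl fun b _ => ?_
    rw [intervalIntegral.integral_const_mul, integral_zpow (Or.inr ⟨by omega, h0⟩), one_zpow,
      zpow_add₀ hu.ne', zpow_one, mul_sub, zpow_sub₀ hu.ne', zpow_mul, zpow_mul, zpow_natCast,
      zpow_natCast]
    push_cast
    have : (3 * ((a : ℝ) - b) + 1) ≠ 0 := by
      have : 3 * ((a : ℤ) - b) + 1 ≠ 0 := by omega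
      exact_mod_cast this
    rw [← mul_sub]
    simp only [z3]
    field_simp
  · intro a _
    have h := IntervalIntegrable.sum (range (n + 1)) fun b _ =>
      (hint (3 * ((a : ℤ) - b))).const_mul
        ((-1 : ℝ) ^ a * n.choose a * ((-1) ^ b * n.choose b) * (u ^ 3) ^ b)
    rwa [Finset.sum_fn] at h

theorem third_add_int_ne_zero (i : ℤ) : (1 / 3 : ℝ) + i ≠ 0 := by
  intro h
  have h' : (1 + 3 * i : ℝ) = 0 := by linarith
  have : 1 + 3 * i = 0 := by exact_mod_cast h'
  omega

theorem neg_third_add_int_ne_zero (i : ℤ) : (-1 / 3 : ℝ) + i ≠ 0 := by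
  have h := third_add_int_ne_zero (-i)
  push_cast at h
  intro h'
  exact h (by linarith)

theorem padePoly_sub_mul_padePoly {u : ℝ} (hu : 0 < u) (n : ℕ) :
    padePoly (1 / 3) n (u ^ 3) - u * padePoly (-1 / 3) n (u ^ 3)
      = padeScale (1 / 3) n * ∫ t in u..1, ((1 - t ^ 3) * (1 - u ^ 3 / t ^ 3)) ^ n := by
  have hne : ∀ a b : ℕ, (3 * ((a : ℝ) - b) + 1) ≠ 0 := fun a b => by
    have : 3 * ((a : ℤ) - b) + 1 ≠ 0 := by omega
    exact_mod_cast this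
  have e1 : padePoly (1 / 3) n (u ^ 3) = padeScale (1 / 3) n *
      ∑ a ∈ range (n + 1), ∑ b ∈ range (n + 1), (-1 : ℝ) ^ a * n.choose a *
          ((-1) ^ b * n.choose b) * ((u ^ 3) ^ b / (3 * (a - b) + 1)) := by
    rw [padePoly, sum_comm, mul_sum]
    refine sum_congr rfl fun b hb => ?_
    rw [← padeScale_mul_sum _ third_add_int_ne_zero n b (Nat.lt_succ_iff.1 (mem_range.1 hb)),
      mul_sum, mul_sum, mul_sum, sum_mul]
    refine sum_congr rfl fun a _ => ?_
    have h1 := hne a b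
    rw [show (1 / 3 : ℝ) - b + a = (3 * (a - b) + 1) / 3 by ring]
    field_simp
  have e2 : u * padePoly (-1 / 3) n (u ^ 3) = padeScale (1 / 3) n *
      ∑ a ∈ range (n + 1), ∑ b ∈ range (n + 1), (-1 : ℝ) ^ a * n.choose a *
          ((-1) ^ b * n.choose b) * (u * (u ^ 3) ^ a / (3 * (a - b) + 1)) := by
    rw [padePoly, mul_sum, mul_sum]
    refine sum_congr rfl fun a ha => ?_
    rw [← padeScale_mul_sum _ neg_third_add_int_ne_zero n a (Nat.lt_succ_iff.1 (mem_range.1 ha)),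
      mul_sum, mul_sum, mul_sum, sum_mul, mul_sum, show (-1 / 3 : ℝ) = -(1 / 3) by ring,
      padeScale_neg]
    refine sum_congr rfl fun b _ => ?_
    have h1 := hne a b
    rw [show -(1 / 3 : ℝ) - a + b = -((3 * (a - b) + 1) / 3) by ring, div_neg]
    field_simp
  rw [e1, e2, integral_padeKernel hu, ← mul_sub, ← sum_sub_distrib]
  congr 1
  refine sum_congr rfl fun a _ => ?_
  rw [← sum_sub_distrib]
  exact sum_congr rfl fun b _ => by rw [sub_div]; ring

theorem padeScale_third_pos (n : ℕ) : 0 < padeScale (1 / 3) n := by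
  unfold padeScale
  have h1 : 0 < ∏ i ∈ range n, ((i : ℝ) + 1 + 1 / 3) := prod_pos fun i _ => by positivity
  have h2 : 0 < ∏ i ∈ range n, ((i : ℝ) + 1 - 1 / 3) := prod_pos fun i _ => by
    have : (0 : ℝ) ≤ i := by positivity
    linarith
  positivity

theorem padeScale_succ_le (n : ℕ) : padeScale (1 / 3) (n + 1) ≤ padeScale (1 / 3) n := by
  rw [padeScale_succ]
  refine mul_le_of_le_one_right (padeScale_third_pos n).le ?_
  have : (0 : ℝ) ≤ (1 / 3) ^ 2 / ((n : ℝ) + 1) ^ 2 := by positivity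
  linarith

theorem padeKernel_integral_pos {u : ℝ} (hu : 0 < u) (hu1 : u < 1) (n : ℕ) :
    0 < ∫ t in u..1, ((1 - t ^ 3) * (1 - u ^ 3 / t ^ 3)) ^ n := by
  refine intervalIntegral.intervalIntegral_pos_of_pos_on ?_ (fun t ht => ?_) hu1
  · refine ContinuousOn.intervalIntegrable fun t ht => ContinuousAt.continuousWithinAt ?_
    have : t ^ 3 ≠ 0 := pow_ne_zero _ ((lt_min hu one_pos).trans_le ht.1).ne'
    fun_prop (disch := assumption)
  · have h0 := hu.trans ht.1
    have h1 : t ^ 3 < 1 := pow_lt_one₀ h0.le ht.2 (by norm_num)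
    have h2 : u ^ 3 / t ^ 3 < 1 := by
      rw [div_lt_one (by positivity)]
      exact pow_lt_pow_left₀ ht.1 hu.le (by norm_num)
    exact pow_pos (mul_pos (by linarith) (by linarith)) n

theorem padeKernel_integral_succ_le {u : ℝ} (hu : 0 < u) (hu3 : u ^ 3 = 125 / 128) (n : ℕ) :
    ∫ t in u..1, ((1 - t ^ 3) * (1 - u ^ 3 / t ^ 3)) ^ (n + 1)
      ≤ 9 / 64000 * ∫ t in u..1, ((1 - t ^ 3) * (1 - u ^ 3 / t ^ 3)) ^ n := by
  have hu1 : u ≤ 1 := by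
    by_contra! h
    have := one_lt_pow₀ h (n := 3) (by norm_num)
    linarith
  have hint : ∀ k : ℕ, IntervalIntegrable
      (fun t : ℝ => ((1 - t ^ 3) * (1 - u ^ 3 / t ^ 3)) ^ k) MeasureTheory.volume u 1 := fun k => by
    refine ContinuousOn.intervalIntegrable fun t ht => ContinuousAt.continuousWithinAt ?_
    have : t ^ 3 ≠ 0 := pow_ne_zero _ ((lt_min hu one_pos).trans_le ht.1).ne'
    fun_prop (disch := assumption)
  rw [← intervalIntegral.integral_const_mul]
  refine intervalIntegral.integral_mono_on hu1 (hint _) ((hint n).const_mul _) fun t ht => ?_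
  have h0 := hu.trans_le ht.1
  have hs : 0 < t ^ 3 := by positivity
  have h1 : t ^ 3 ≤ 1 := pow_le_one₀ h0.le ht.2
  have h2 : u ^ 3 / t ^ 3 ≤ 1 := by
    rw [div_le_one hs]
    exact pow_le_pow_left₀ hu.le ht.1 3
  have h3 : (1 - t ^ 3) * (1 - u ^ 3 / t ^ 3) ≤ 9 / 64000 := by
    rw [hu3]
    generalize t ^ 3 = s at hs
    rw [show (1 - s) * (1 - 125 / 128 / s) = (1 - s) * (s - 125 / 128) / s by field_simp,
      div_le_iff₀ hs]
    nlinarith [sq_nonneg (s - 126491 / 128000)]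
  rw [pow_succ, mul_comm]
  exact mul_le_mul_of_nonneg_right h3
    (pow_nonneg (mul_nonneg (by linarith) (by linarith)) n)

theorem three_pow_half_le_sqrt_pow (n : ℕ) : (3 : ℝ) ^ (n / 2) ≤ √3 ^ n := by
  have h : √(3 : ℝ) ^ 2 = 3 := Real.sq_sqrt (by norm_num)
  calc (3 : ℝ) ^ (n / 2) = √3 ^ (2 * (n / 2)) := by rw [pow_mul, h]
    _ ≤ √3 ^ n := pow_le_pow_right₀ (Real.one_le_sqrt.2 (by norm_num)) (Nat.mul_div_le n 2)

/-- Rational approximations to the cube root of `2` of controlled quality. -/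
theorem exists_approx_cbrt_two {θ : ℝ} (hθ : 0 < θ) (hθ3 : θ ^ 3 = 2) :
    ∃ p q : ℕ → ℤ, (∀ n, |(q n : ℝ)| ≤ 8 * (506 * √3) ^ n) ∧
      (∀ n, |q n * θ - p n| ≤ 1 / 25 * (9 / 500 * √3) ^ n) ∧
      ∀ n, p n * q (n + 1) ≠ p (n + 1) * q n := by
  have hθl : 5 / 4 < θ := lt_of_pow_lt_pow_left₀ 3 hθ.le (by rw [hθ3]; norm_num)
  have hθu : θ ≤ 126 / 100 := le_of_pow_le_pow_left₀ (n := 3) (by norm_num) (by norm_num)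
    (by rw [hθ3]; norm_num)
  set u : ℝ := 5 / (4 * θ) with hu
  have hu0 : 0 < u := by positivity
  have hu1 : u < 1 := by rw [hu, div_lt_one (by positivity)]; linarith
  have hu3 : u ^ 3 = 125 / 128 := by rw [hu, div_pow, mul_pow, hθ3]; norm_num
  have hθu5 : 4 * θ * u = 5 := by rw [hu]; field_simp
  set A : ℕ → ℝ := fun n => padePoly (1 / 3) n (125 / 128) with hA
  set B : ℕ → ℝ := fun n => padePoly (-1 / 3) n (125 / 128) with hB
  set δ : ℕ → ℝ := fun n => A n - u * B n with hδ
  have hδe : ∀ n, δ n = padeScale (1 / 3) n *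
      ∫ t in u..1, ((1 - t ^ 3) * (1 - u ^ 3 / t ^ 3)) ^ n := fun n => by
    rw [← padePoly_sub_mul_padePoly hu0, hu3]
  have hδ0 : ∀ n, 0 < δ n := fun n => by
    rw [hδe]
    exact mul_pos (padeScale_third_pos n) (padeKernel_integral_pos hu0 hu1 n)
  have hδs : ∀ n, δ (n + 1) ≤ 9 / 64000 * δ n := fun n => by
    rw [hδe, hδe]
    have h1 := padeScale_succ_le n
    have h2 := padeKernel_integral_succ_le hu0 hu3 n
    have h3 := padeKernel_integral_pos hu0 hu1 (n + 1)
    have h4 := padeScale_third_pos n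
    refine (mul_le_mul h1 h2 h3.le h4.le).trans_eq (by ring)
  have hδn : ∀ n, δ n ≤ (9 / 64000) ^ n * (1 - u) := fun n => by
    induction n with
    | zero => simp [hδ, hA, hB, padePoly]
    | succ n ih =>
      have := hδs n
      rw [pow_succ]
      linarith
  have hA0 : ∀ n, 0 < A n := fun n => by
    have h1 := hδ0 n
    have h2 : 1 ≤ B n := one_le_padePoly (by norm_num) (by norm_num) (by norm_num) n
    have h3 : 0 < u * B n := by positivity
    simp only [hδ] at h1
    linarith
  choose a ha using exists_int_mul_padePoly 1
  choose b hb using exists_int_mul_padePoly (-1)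
  have ha' : ∀ n, (a n : ℝ) = 128 ^ n * 3 ^ (n / 2) * A n := fun n => by
    rw [← ha n]; push_cast; rfl
  have hb' : ∀ n, (b n : ℝ) = 128 ^ n * 3 ^ (n / 2) * B n := fun n => by
    rw [← hb n]; push_cast; rfl
  refine ⟨fun n => 5 * b n, fun n => 4 * a n, fun n => ?_, fun n => ?_, fun n h => ?_⟩
  · push_cast
    rw [ha', abs_of_nonneg (by have := (hA0 n).le; positivity)]
    have h1 : A n ≤ 2 * (2 * (1 + 125 / 128)) ^ n :=
      padePoly_le (by norm_num) (by norm_num) (by norm_num) n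
    have h2 := three_pow_half_le_sqrt_pow n
    have h3 := (hA0 n).le
    calc 4 * (128 ^ n * 3 ^ (n / 2) * A n)
        ≤ 4 * (128 ^ n * √3 ^ n * (2 * (2 * (1 + 125 / 128)) ^ n)) := by gcongr
      _ = 8 * (128 ^ n * (2 * (1 + 125 / 128)) ^ n * √3 ^ n) := by ring
      _ = _ := by rw [← mul_pow, ← mul_pow]; norm_num
  · push_cast
    have e : 4 * (a n : ℝ) * θ - 5 * b n = 4 * θ * (128 ^ n * 3 ^ (n / 2)) * δ n := by
      rw [ha', hb', ← hθu5]; simp only [hδ]; ring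
    have h1 := (hδ0 n).le
    rw [e, abs_of_nonneg (by positivity)]
    have h2 := three_pow_half_le_sqrt_pow n
    calc 4 * θ * (128 ^ n * 3 ^ (n / 2)) * δ n
        ≤ 4 * θ * (128 ^ n * √3 ^ n) * ((9 / 64000) ^ n * (1 - u)) := by
          have := hδn n
          gcongr
      _ = (4 * θ - 4 * θ * u) * (128 ^ n * (9 / 64000) ^ n * √3 ^ n) := by ring
      _ = (4 * θ - 5) * (9 / 500 * √3) ^ n := by
          rw [hθu5, ← mul_pow, ← mul_pow]; norm_num
      _ ≤ _ := by gcongr; linarith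
  · have h' : (5 * b n : ℝ) * (4 * a (n + 1)) = 5 * b (n + 1) * (4 * a n) := by exact_mod_cast h
    have hD : ∀ k : ℕ, (128 : ℝ) ^ k * 3 ^ (k / 2) ≠ 0 := fun k => by positivity
    have h1 : B n * A (n + 1) = B (n + 1) * A n := by
      rw [ha', ha', hb', hb'] at h'
      refine mul_left_cancel₀ (mul_ne_zero (hD n) (hD (n + 1))) ?_
      linear_combination h' / 20
    have h2 : B n * δ (n + 1) = B (n + 1) * δ n := by
      simp only [hδ]; linear_combination h1
    have h3 : 1 ≤ B n := one_le_padePoly (by norm_num) (by norm_num) (by norm_num) n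
    have h4 : B n ≤ B (n + 1) := padePoly_le_succ (by norm_num) (by norm_num) (by norm_num) n
    have h5 := hδs n
    have h6 := hδ0 n
    have h7 : B n * δ (n + 1) < B n * δ n := mul_lt_mul_of_pos_left (by linarith) (by linarith)
    have h8 : B n * δ n ≤ B (n + 1) * δ n := mul_le_mul_of_nonneg_right h4 h6.le
    linarith

theorem abs_le_of_cube_sub_two_mul_cube {m x y : ℤ} (hm : m ≠ 0) (h : x ^ 3 - 2 * y ^ 3 = m) :
    |y| ≤ (140000 * |m|) ^ 23 := by
  obtain ⟨θ, hθ, hθ3⟩ : ∃ θ : ℝ, 0 < θ ∧ θ ^ 3 = 2 :=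
    ⟨2 ^ ((1 : ℝ) / 3), by positivity, by
      rw [← Real.rpow_natCast, ← Real.rpow_mul (by norm_num)]; norm_num⟩
  have hM1 : (1 : ℝ) ≤ |(m : ℝ)| := by exact_mod_cast Int.one_le_abs hm
  suffices H : |(y : ℝ)| ≤ (140000 * |(m : ℝ)|) ^ 23 by exact_mod_cast H
  rcases eq_or_ne y 0 with rfl | hy
  · simp only [Int.cast_zero, abs_zero]; positivity
  have hY1 : (1 : ℝ) ≤ |(y : ℝ)| := by exact_mod_cast Int.one_le_abs hy
  obtain ⟨p, q, hq, hL, hne⟩ := exists_approx_cbrt_two hθ hθ3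
  set Y := |(y : ℝ)| with hYdef
  set M := |(m : ℝ)| with hMdef
  have hs0 : 0 ≤ √(3 : ℝ) := Real.sqrt_nonneg 3
  have hs : √(3 : ℝ) ^ 2 = 3 := Real.sq_sqrt (by norm_num)
  have hs1 : 1 ≤ √(3 : ℝ) := Real.one_le_sqrt.2 (by norm_num)
  have hs2 : √(3 : ℝ) ≤ 2 := by nlinarith
  set Q := 506 * √(3 : ℝ) with hQ
  set r := 9 / 500 * √(3 : ℝ) with hr
  have hQ1 : 1 ≤ Q := by rw [hQ]; linarith
  have hr0 : 0 < r := by rw [hr]; linarith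
  have hr1 : r < 1 := by rw [hr]; linarith
  have hQr : Q ^ 23 * r ^ 45 ≤ 1 := by
    have : Q ^ 23 * r ^ 45 = 506 ^ 23 * (9 / 500) ^ 45 * (√3 ^ 2) ^ 34 := by rw [hQ, hr]; ring
    rw [this, hs]; norm_num
  set e := |(x : ℝ) - θ * y| with he
  have heY : e * Y ^ 2 ≤ M := by
    have hθl : 6 / 5 ≤ θ := le_of_pow_le_pow_left₀ (n := 3) (by norm_num) hθ.le
      (by rw [hθ3]; norm_num)
    have h1 : ((x : ℝ) - θ * y) * (x ^ 2 + θ * x * y + θ ^ 2 * y ^ 2) = m := by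
      have : (x : ℝ) ^ 3 - 2 * y ^ 3 = m := by exact_mod_cast h
      rw [← this, ← hθ3]; ring
    have h2 : (y : ℝ) ^ 2 ≤ x ^ 2 + θ * x * y + θ ^ 2 * y ^ 2 := by
      have : (4 / 3 : ℝ) ≤ θ ^ 2 := by nlinarith
      nlinarith [sq_nonneg ((x : ℝ) + θ * y / 2), sq_nonneg (y : ℝ)]
    rw [hMdef, ← h1, abs_mul, hYdef, sq_abs]
    exact mul_le_mul_of_nonneg_left (h2.trans (le_abs_self _)) (abs_nonneg _)
  have hex : ∃ n : ℕ, Y * r ^ n ≤ 25 / 2 := by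
    obtain ⟨n, hn⟩ := exists_pow_lt_of_lt_one (show 0 < 25 / 2 / Y by positivity) hr1
    exact ⟨n, by rw [lt_div_iff₀ (by positivity)] at hn; linarith⟩
  classical
  obtain ⟨n, hn, hmin⟩ : ∃ n : ℕ, Y * r ^ n ≤ 25 / 2 ∧ ∀ j < n, 25 / 2 < Y * r ^ j :=
    ⟨Nat.find hex, Nat.find_spec hex, fun j hj => not_le.1 (Nat.find_min hex hj)⟩
  have key : Y ^ 2 ≤ 16 * Q ^ (n + 1) * M := by
    obtain ⟨k, hnk, hkn, hk⟩ : ∃ k, n ≤ k ∧ k ≤ n + 1 ∧ q k * x - p k * y ≠ 0 := by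
      by_contra! hcon
      have h1 := hcon n le_rfl (Nat.le_succ n)
      have h2 := hcon (n + 1) (Nat.le_succ n) le_rfl
      refine hne n (mul_right_cancel₀ hy ?_)
      linear_combination q n * h2 - q (n + 1) * h1
    have h1 : (1 : ℝ) ≤ |(q k : ℝ) * x - p k * y| := by exact_mod_cast Int.one_le_abs hk
    have h2 : (q k : ℝ) * x - p k * y = q k * (x - θ * y) + y * (q k * θ - p k) := by ring
    have h3 : |(q k : ℝ)| ≤ 8 * Q ^ (n + 1) :=
      (hq k).trans (by gcongr)
    have h4 : |q k * θ - p k| ≤ 1 / 25 * r ^ n :=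
      (hL k).trans (mul_le_mul_of_nonneg_left (pow_le_pow_of_le_one hr0.le hr1.le hnk) (by norm_num))
    have h5 : 1 ≤ 8 * Q ^ (n + 1) * e + Y * (1 / 25 * r ^ n) := by
      refine h1.trans ?_
      rw [h2]
      refine (abs_add_le _ _).trans ?_
      rw [abs_mul, abs_mul]
      gcongr
    have h6 : 1 ≤ 16 * Q ^ (n + 1) * e := by linarith
    calc Y ^ 2 ≤ (16 * Q ^ (n + 1) * e) * Y ^ 2 := le_mul_of_one_le_left (by positivity) h6
      _ = 16 * Q ^ (n + 1) * (e * Y ^ 2) := by ring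
      _ ≤ _ := by gcongr
  rcases n with _ | j
  · calc Y ≤ Y ^ 2 := by nlinarith
      _ ≤ 16 * Q ^ (0 + 1) * M := key
      _ ≤ 140000 * M := by
          have : Q ≤ 1012 := by rw [hQ]; linarith
          rw [zero_add, pow_one]
          gcongr
          linarith
      _ ≤ _ := le_self_pow₀ (by linarith) (by norm_num)
  · have h1 : 25 / 2 < Y * r ^ j := hmin j (Nat.lt_succ_self j)
    have hQ2 : Q ^ 2 = 768108 := by rw [hQ, mul_pow, hs]; norm_num
    have h2 : Y ^ 2 ≤ 12289728 * M * Q ^ j := by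
      refine key.trans_eq ?_
      rw [show j + 1 + 1 = 2 + j by ring, pow_add, hQ2]; ring
    have h3 : Y * (25 / 2) ^ 45 ≤ (12289728 * M) ^ 23 := by
      calc Y * (25 / 2) ^ 45 ≤ Y * (Y * r ^ j) ^ 45 := by gcongr
        _ = (Y ^ 2) ^ 23 * r ^ (45 * j) := by rw [mul_pow, ← pow_mul r, mul_comm j]; ring
        _ ≤ (12289728 * M * Q ^ j) ^ 23 * r ^ (45 * j) := by gcongr
        _ = (12289728 * M) ^ 23 * (Q ^ 23 * r ^ 45) ^ j := by
            rw [mul_pow _ (Q ^ j), mul_pow (Q ^ 23), ← pow_mul Q, ← pow_mul Q, ← pow_mul r,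
              mul_comm j, mul_assoc]
        _ ≤ (12289728 * M) ^ 23 * 1 := by
            gcongr
            exact pow_le_one₀ (by positivity) hQr
        _ = _ := mul_one _
    have h4 : (12289728 * M) ^ 23 ≤ (140000 * M) ^ 23 * (25 / 2) ^ 45 := by
      rw [mul_pow, mul_pow, mul_right_comm]
      gcongr
      norm_num
    exact le_of_mul_le_mul_right (h3.trans h4) (by positivity)

end CubicPade

/-- **Baker's effective bound for the Thue equation `x³ − 2y³ = m` (1964).**
For every nonzero integer `m`, all integers `x`, `y` with `x³ − 2y³ = m` satisfy
`max {|x|, |y|} ≤ (300000 |m|)^23`. -/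
theorem baker_thue_bound (m : ℤ) (hm : m ≠ 0) (x y : ℤ) (h : x ^ 3 - 2 * y ^ 3 = m) :
    max |x| |y| ≤ (300000 * |m|) ^ 23 := by
  have hM : 1 ≤ |m| := Int.one_le_abs hm
  have hy := CubicPade.abs_le_of_cube_sub_two_mul_cube hm h
  have hMN : |m| ≤ (140000 * |m|) ^ 23 :=
    (by linarith : |m| ≤ 140000 * |m|).trans (le_self_pow₀ (by linarith) (by norm_num))
  have hN : 2 * (140000 * |m|) ^ 23 ≤ (300000 * |m|) ^ 23 := by
    rw [mul_pow, mul_pow, ← mul_assoc]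
    gcongr
    norm_num
  generalize (140000 * |m|) ^ 23 = N at *
  have hx3 : |x| ^ 3 ≤ |m| + 2 * |y| ^ 3 := by
    rw [← abs_pow, ← abs_pow, show x ^ 3 = m + 2 * y ^ 3 by linarith]
    refine (abs_add_le _ _).trans_eq ?_
    rw [abs_mul, abs_two]
  have hN1 : 1 ≤ N := hM.trans hMN
  have hx : |x| ≤ 2 * N := by
    refine le_of_pow_le_pow_left₀ (n := 3) (by norm_num) (by linarith) (hx3.trans ?_)
    have h1 : |y| ^ 3 ≤ N ^ 3 := pow_le_pow_left₀ (abs_nonneg y) hy 3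
    have h2 : N ≤ N ^ 3 := le_self_pow₀ hN1 (by norm_num)
    rw [mul_pow]
    linarith
  exact max_le (hx.trans hN) (by linarith)
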